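/- arXiv:1604.05948 — 7 statements merged into one kernel-verified Lean document; each statement's English description precedes it below -/
import Mathlib

section
/- Let G be a totally disconnected groupoid. Then the relation B = {(f, (id_{dom(f)}, f)) : f ∈ Mor(G)} ∪ {(f, (f, id_{dom(f)})) : f ∈ Mor(G)} ⊆ Mor(G) × (Mor(G) × Mor(G)) is a broadcasting relation on G. Hence every totally disconnected groupoid is a broadcastable object of CP*[Rel]. -/
open CategoryTheory

/-- A morphism of a groupoid, bundled with its domain and codomain. -/
def Mor (G : Type*) [Groupoid G] : Type _ := Σ (x : G) (y : G), x ⟶ y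

namespace Mor

variable {G : Type*} [Groupoid G]

/-- Domain of a bundled morphism. -/
def dom (f : Mor G) : G := f.1

/-- Codomain of a bundled morphism. -/
def cod (f : Mor G) : G := f.2.1

/-- Inverse of a bundled morphism. -/
def inv (f : Mor G) : Mor G := ⟨f.2.1, f.1, Groupoid.inv f.2.2⟩

/-- The identity at an object, as a bundled morphism. -/
def idm (x : G) : Mor G := ⟨x, x, 𝟙 x⟩

/-- `comp g h e` is the composite `g ∘ h` (first `h`, then `g`),
defined when `cod h = dom g`. -/
def comp (g h : Mor G) (e : h.cod = g.dom) : Mor G :=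
  ⟨h.1, g.2.1, h.2.2 ≫ eqToHom e ≫ g.2.2⟩

end Mor

/-- A broadcasting relation on a groupoid `G`: a relation
`B ⊆ Mor(G) × (Mor(G) × Mor(G))` that respects inverses (with respect to `G` and the
product groupoid `G × G`) and satisfies, for all morphisms `f`, `g`:
`(f, (id_{cod g}, g)) ∈ B ⟺ f = g` and `(f, (g, id_{dom g})) ∈ B ⟺ f = g`. -/
def IsBroadcasting {G : Type*} [Groupoid G]
    (B : Set (Mor G × (Mor G × Mor G))) : Prop :=
  (∀ f g h : Mor G, (f, (g, h)) ∈ B ↔ (f.inv, (g.inv, h.inv)) ∈ B) ∧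
  (∀ f g h : Mor G, (f, (g, h)) ∈ B →
    (Mor.idm f.dom, (Mor.idm g.dom, Mor.idm h.dom)) ∈ B) ∧
  (∀ f g : Mor G, (f, (Mor.idm g.cod, g)) ∈ B ↔ f = g) ∧
  (∀ f g : Mor G, (f, (g, Mor.idm g.dom)) ∈ B ↔ f = g)

namespace Mor

variable {G : Type*} [Groupoid G]

theorem inv_inv (f : Mor G) : f.inv.inv = f := by
  obtain ⟨x, y, f⟩ := f
  exact congrArg (fun k => (⟨x, y, k⟩ : Mor G))
    (show Groupoid.inv (Groupoid.inv f) = f by simp)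

theorem inv_idm (x : G) : (idm x).inv = idm x :=
  congrArg (fun k => (⟨x, x, k⟩ : Mor G)) (show Groupoid.inv (𝟙 x) = 𝟙 x by simp)

theorem dom_inv (f : Mor G) : f.inv.dom = f.cod := rfl

theorem dom_idm (x : G) : (idm x).dom = x := rfl

theorem cod_idm (x : G) : (idm x).cod = x := rfl

end Mor

/-- If `G` is a totally disconnected groupoid, then
`B = {(f, (id_{dom f}, f))} ∪ {(f, (f, id_{dom f}))}` is a broadcasting relation on `G`;
hence every totally disconnected groupoid is a broadcastable object of `CP*[Rel]`. -/
theorem broadcastable_of_totallyDisconnected {G : Type*} [Groupoid G]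
    (htd : ∀ f : Mor G, f.dom = f.cod) :
    IsBroadcasting {p : Mor G × (Mor G × Mor G) |
      (∃ f : Mor G, p = (f, (Mor.idm f.dom, f))) ∨
      (∃ f : Mor G, p = (f, (f, Mor.idm f.dom)))} := by
  have inv_mem : ∀ f g h : Mor G,
      ((∃ k : Mor G, (f, (g, h)) = (k, (Mor.idm k.dom, k))) ∨
        (∃ k : Mor G, (f, (g, h)) = (k, (k, Mor.idm k.dom)))) →
      ((∃ k : Mor G, (f.inv, (g.inv, h.inv)) = (k, (Mor.idm k.dom, k))) ∨
        (∃ k : Mor G, (f.inv, (g.inv, h.inv)) = (k, (k, Mor.idm k.dom)))) := by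
    rintro f g h (⟨k, hk⟩ | ⟨k, hk⟩) <;> simp only [Prod.mk.injEq] at hk <;>
      obtain ⟨rfl, rfl, rfl⟩ := hk
    · exact Or.inl ⟨h.inv, by rw [Mor.inv_idm, Mor.dom_inv, htd]⟩
    · exact Or.inr ⟨g.inv, by rw [Mor.inv_idm, Mor.dom_inv, htd]⟩
  refine ⟨fun f g h => ⟨inv_mem f g h, fun H => ?_⟩, ?_, fun f g => ⟨?_, ?_⟩, fun f g => ⟨?_, ?_⟩⟩
  · simpa only [Mor.inv_inv, Set.mem_ofPred_eq] using inv_mem _ _ _ H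
  · rintro f g h (⟨k, hk⟩ | ⟨k, hk⟩) <;> simp only [Prod.mk.injEq] at hk <;>
      obtain ⟨rfl, rfl, rfl⟩ := hk
    · exact Or.inl ⟨Mor.idm h.dom, rfl⟩
    · exact Or.inr ⟨Mor.idm g.dom, rfl⟩
  · rintro (⟨k, hk⟩ | ⟨k, hk⟩) <;> simp only [Prod.mk.injEq] at hk <;>
      obtain ⟨rfl, h₁, h₂⟩ := hk
    · exact h₂.symm
    · rw [← h₁, h₂, Mor.cod_idm]
  · rintro rfl
    exact Or.inl ⟨f, by rw [htd]⟩
  · rintro (⟨k, hk⟩ | ⟨k, hk⟩) <;> simp only [Prod.mk.injEq] at hk <;>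
      obtain ⟨rfl, h₁, h₂⟩ := hk
    · rw [← h₂, h₁, Mor.dom_idm]
    · exact h₁.symm
  · rintro rfl
    exact Or.inr ⟨f, rfl⟩
end

section
/- Let G be a groupoid and suppose the identity relation {(g,g) : g ∈ Mor(G)} on Mor(G) can be written as a relational composite T' ∘ S, where S ⊆ Mor(G) × Mor(T) and T' ⊆ Mor(T) × Mor(G) are inverse-respecting relations and T is a totally disconnected groupoid. Then G is itself totally disconnected. -/
open CategoryTheory

/-- A relation `R ⊆ Mor(G) × Mor(H)` between the morphism sets of two groupoids
respects inverses when `(g,h) ∈ R ⟺ (g⁻¹,h⁻¹) ∈ R` and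
`(g,h) ∈ R ⟹ (id_{dom g}, id_{dom h}) ∈ R`. -/
def RespectsInv {G H : Type*} [Groupoid G] [Groupoid H]
    (R : Set (Mor G × Mor H)) : Prop :=
  (∀ g h, (g, h) ∈ R ↔ (Mor.inv g, Mor.inv h) ∈ R) ∧
  (∀ g h, (g, h) ∈ R → (Mor.idm (Mor.dom g), Mor.idm (Mor.dom h)) ∈ R)

/-- Relational composition: `(a,c) ∈ relComp S T' ⟺ ∃ b, (a,b) ∈ S ∧ (b,c) ∈ T'`. -/
def relComp {A T B : Type*} [Groupoid A] [Groupoid T] [Groupoid B]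
    (S : Set (Mor A × Mor T)) (T' : Set (Mor T × Mor B)) :
    Set (Mor A × Mor B) :=
  {p | ∃ b : Mor T, (p.1, b) ∈ S ∧ (b, p.2) ∈ T'}

/-- If the identity relation on `Mor(G)` factors as `T' ∘ S` through a totally
disconnected groupoid `T` via inverse-respecting relations, then `G` itself is
totally disconnected. -/
theorem totallyDisconnected_of_id_factors {G T : Type*} [Groupoid G] [Groupoid T]
    (htd : ∀ f : Mor T, f.dom = f.cod)
    (S : Set (Mor G × Mor T)) (T' : Set (Mor T × Mor G))
    (hS : RespectsInv S) (hT' : RespectsInv T')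
    (hid : {p : Mor G × Mor G | p.1 = p.2} = relComp S T') :
    ∀ f : Mor G, f.dom = f.cod := by
  intro f
  obtain ⟨t, hft, htf⟩ : (f, f) ∈ relComp S T' := hid ▸ (rfl : f = f)
  have hdom : (Mor.idm f.dom, Mor.idm t.dom) ∈ S := hS.2 _ _ hft
  have hcod : (Mor.idm t.cod, Mor.idm f.cod) ∈ T' := hT'.2 _ _ ((hT'.1 _ _).1 htf)
  rw [htd t] at hdom
  have hmem : (Mor.idm f.dom, Mor.idm f.cod) ∈ relComp S T' := ⟨_, hdom, hcod⟩
  rw [← hid] at hmem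
  exact congrArg Mor.dom hmem
end

section
/- Let A be a set with at least two elements and let G be the indiscrete groupoid on A. Then the identity relation on Mor(G) cannot be written as a relational composite T' ∘ S of inverse-respecting relations S ⊆ Mor(G) × Mor(T) and T' ⊆ Mor(T) × Mor(G) through any totally disconnected groupoid T. (This expresses that the category CP*[Rel] is nonlocal.) -/
open CategoryTheory

/-- The indiscrete groupoid on a set `A`: exactly one morphism between any two objects. -/
def Indiscrete (A : Type*) : Type _ := A

instance (A : Type*) : Groupoid (Indiscrete A) where
  Hom _ _ := PUnit
  id _ := ⟨⟩
  comp _ _ := ⟨⟩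
  inv _ := ⟨⟩

/-- If `A` has at least two elements, the identity relation on the morphisms of the
indiscrete groupoid on `A` cannot be factored as a relational composite `T' ∘ S` of
inverse-respecting relations through any totally disconnected groupoid `T`.
(`CP*[Rel]` is nonlocal.) -/
theorem indiscrete_id_not_factor {A : Type*} (a b : A) (hab : a ≠ b) :
    ∀ (T : Type*) [Groupoid T], (∀ f : Mor T, f.dom = f.cod) →
      ∀ (S : Set (Mor (Indiscrete A) × Mor T)) (T' : Set (Mor T × Mor (Indiscrete A))),
        RespectsInv S → RespectsInv T' →
        {p : Mor (Indiscrete A) × Mor (Indiscrete A) | p.1 = p.2} ≠ relComp S T' := by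
  intro T _ hT S T' hS hT' h
  obtain ⟨t, hft, htf⟩ : ((⟨a, b, ⟨⟩⟩, ⟨a, b, ⟨⟩⟩) : Mor (Indiscrete A) × Mor (Indiscrete A)) ∈
      relComp S T' := h ▸ rfl
  have hb : (Mor.idm (G := Indiscrete A) b, Mor.idm t.cod) ∈ S := hS.2 _ _ ((hS.1 _ _).1 hft)
  have ha : (Mor.idm t.dom, Mor.idm (G := Indiscrete A) a) ∈ T' := hT'.2 _ _ htf
  rw [← hT t] at hb
  have hba : (Mor.idm (G := Indiscrete A) b, Mor.idm (G := Indiscrete A) a) ∈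
      {p : Mor (Indiscrete A) × Mor (Indiscrete A) | p.1 = p.2} := h ▸ ⟨_, hb, ha⟩
  exact hab (congrArg Mor.dom hba).symm
end

section
/- Let G be a groupoid and let A and B be wide subgroupoids of G. Say A and B are kinematically independent when for all a ∈ Mor(A) and b ∈ Mor(B): the composite a ∘ b is defined if and only if the composite b ∘ a is defined, and in that case a ∘ b = b ∘ a. Then A and B are kinematically independent if and only if both A and B are totally disconnected and, for every object x of G, a ∘ b = b ∘ a for all endomorphisms a ∈ A(x,x) and b ∈ B(x,x) (equivalently, the subgroups A_x = A(x,x) and B_x = B(x,x) of G(x,x) have trivial commutator [A_x, B_x] = {id_x}). -/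
open CategoryTheory

/-- A wide subgroupoid of a groupoid `G`, presented as a set of (bundled) morphisms
containing all identities and closed under inverses and (defined) composition. -/
structure WideSubgroupoid (G : Type*) [Groupoid G] where
  mor : Set (Mor G)
  idm_mem : ∀ x : G, Mor.idm x ∈ mor
  inv_mem : ∀ f ∈ mor, Mor.inv f ∈ mor
  comp_mem : ∀ g ∈ mor, ∀ h ∈ mor, ∀ e : Mor.cod h = Mor.dom g, Mor.comp g h e ∈ mor

/-- Two wide subgroupoids `A`, `B` of `G` are kinematically independent when for all
`a ∈ A` and `b ∈ B`: `a ∘ b` is defined iff `b ∘ a` is defined, and in that case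
`a ∘ b = b ∘ a`. -/
def KinematicallyIndependent {G : Type*} [Groupoid G]
    (A B : WideSubgroupoid G) : Prop :=
  ∀ a ∈ A.mor, ∀ b ∈ B.mor,
    (Mor.cod b = Mor.dom a ↔ Mor.cod a = Mor.dom b) ∧
    (∀ (e : Mor.cod b = Mor.dom a) (e' : Mor.cod a = Mor.dom b),
      Mor.comp a b e = Mor.comp b a e')

theorem Mor.comp_mk {G : Type*} [Groupoid G] {x y z : G} (g : y ⟶ z) (h : x ⟶ y)
    (e : Mor.cod ⟨x, y, h⟩ = Mor.dom ⟨y, z, g⟩) :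
    Mor.comp ⟨y, z, g⟩ ⟨x, y, h⟩ e = ⟨x, z, h ≫ g⟩ := by
  change (⟨x, z, h ≫ 𝟙 y ≫ g⟩ : Mor G) = _
  rw [Category.id_comp]

theorem Mor.mk_injective {G : Type*} [Groupoid G] {x y : G} :
    Function.Injective fun f : x ⟶ y => (⟨x, y, f⟩ : Mor G) :=
  (sigma_mk_injective (i := x)).comp sigma_mk_injective

/-- Wide subgroupoids `A` and `B` of `G` are kinematically independent iff both are
totally disconnected and, at each object `x`, the endomorphisms of `A` commute with
those of `B` (i.e. the subgroups `A(x,x)` and `B(x,x)` of `G(x,x)` commute). -/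
theorem kinematicallyIndependent_iff {G : Type*} [Groupoid G]
    (A B : WideSubgroupoid G) :
    KinematicallyIndependent A B ↔
      ((∀ a ∈ A.mor, Mor.dom a = Mor.cod a) ∧
       (∀ b ∈ B.mor, Mor.dom b = Mor.cod b) ∧
       (∀ (x : G) (a b : x ⟶ x),
         (⟨x, x, a⟩ : Mor G) ∈ A.mor → (⟨x, x, b⟩ : Mor G) ∈ B.mor →
         a ≫ b = b ≫ a)) := by
  constructor
  · intro h
    refine ⟨fun a ha => ?_, fun b hb => ?_, fun x a b ha hb => ?_⟩
    · exact ((h a ha _ (B.idm_mem a.dom)).1.1 rfl).symm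
    · exact ((h _ (A.idm_mem b.dom) b hb).1.2 rfl).symm
    · have hab := (h _ ha _ hb).2 rfl rfl
      exact Mor.mk_injective
        ((Mor.comp_mk b a rfl).symm.trans (hab.symm.trans (Mor.comp_mk a b rfl)))
  · rintro ⟨hA, hB, hc⟩ a ha b hb
    have hda := hA a ha
    have hdb := hB b hb
    refine ⟨⟨fun e => hda.symm.trans (e.symm.trans hdb.symm),
      fun e => hdb.symm.trans (e.symm.trans hda.symm)⟩, fun e e' => ?_⟩
    obtain ⟨x, y, a⟩ := a
    obtain ⟨z, w, b⟩ := b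
    obtain rfl : x = y := hda
    obtain rfl : z = w := hdb
    obtain rfl : z = x := e
    exact (Mor.comp_mk a b rfl).trans
      ((congrArg (fun f : z ⟶ z => (⟨z, z, f⟩ : Mor G)) (hc z a b ha hb).symm).trans
        (Mor.comp_mk b a rfl).symm)
end

section
/- Let M = {0,1,2} and N = {x,y} (a two-element set), and set H = {(0,x),(1,y),(2,y)} ⊆ M × N and T = {(0,y),(1,x),(2,x)} ⊆ M × N. Define H' = {((i,j),(u,v)) ∈ (M × M) × (N × N) : (i,u) ∈ H and (j,v) ∈ H} and T' = {((i,j),(u,v)) ∈ (M × M) × (N × N) : (i,u) ∈ T and (j,v) ∈ T}. Then there is no function f : M × M → M × M such that {(f(p), q) : (p,q) ∈ H'} = T'. (This is the binding property of the secure bit commitment protocol in CP*[Rel]: no local operation of Alice, i.e. no bijection of the 9-element set M × M, converts the committed state H into T.) -/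
/-- Alice's commitment to heads: `H = {(0,x),(1,y),(2,y)}` with `x = false`, `y = true`. -/
def headsRel : Set (Fin 3 × Bool) := {(0, false), (1, true), (2, true)}

/-- Alice's commitment to tails: `T = {(0,y),(1,x),(2,x)}`. -/
def tailsRel : Set (Fin 3 × Bool) := {(0, true), (1, false), (2, false)}

/-- The state of the composite system corresponding to `H`. -/
def headsState : Set ((Fin 3 × Fin 3) × (Bool × Bool)) :=
  {p | (p.1.1, p.2.1) ∈ headsRel ∧ (p.1.2, p.2.2) ∈ headsRel}

/-- The state of the composite system corresponding to `T`. -/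
def tailsState : Set ((Fin 3 × Fin 3) × (Bool × Bool)) :=
  {p | (p.1.1, p.2.1) ∈ tailsRel ∧ (p.1.2, p.2.2) ∈ tailsRel}

theorem eq_zero_of_mem_headsRel_false {i : Fin 3} (h : (i, false) ∈ headsRel) : i = 0 := by
  simpa [headsRel] using h

/-- The binding property of the secure bit commitment protocol in `CP*[Rel]`:
no function (in particular, no bijection) `f` on the 9-element set `Fin 3 × Fin 3`
transforms the committed state `H'` into `T'` by acting on Alice's half. -/
theorem bit_commitment_binding :
    ¬ ∃ f : Fin 3 × Fin 3 → Fin 3 × Fin 3,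
        {q : (Fin 3 × Fin 3) × (Bool × Bool) |
          ∃ p ∈ headsState, q = (f p.1, p.2)} = tailsState := by
  rintro ⟨f, hf⟩
  have eq_image (a : Fin 3 × Fin 3) (ha : (a, (false, false)) ∈ tailsState) : a = f (0, 0) := by
    rw [← hf] at ha
    obtain ⟨⟨⟨i, j⟩, q⟩, ⟨hi, hj⟩, h⟩ := ha
    obtain ⟨rfl, rfl⟩ := Prod.mk.inj h
    exact congrArg f (Prod.ext (eq_zero_of_mem_headsRel_false hi)
      (eq_zero_of_mem_headsRel_false hj))
  have h₁ := eq_image (1, 1) (by simp [tailsState, tailsRel])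
  have h₂ := eq_image (2, 2) (by simp [tailsState, tailsRel])
  exact absurd (h₁.trans h₂.symm) (by decide)
end

section
/- Let G be a groupoid in which every morphism is an endomorphism and in which each endomorphism group G(x,x) is abelian. Then the relation Δ = {(f, (g,h)) : g ∘ h is defined and g ∘ h = f} ⊆ Mor(G) × (Mor(G) × Mor(G)) is a broadcasting relation on G. (This is the instance in Rel of the fact that commutative dagger Frobenius structures are broadcastable via their comultiplication.) -/
open CategoryTheory

namespace Mor

variable {G : Type*} [Groupoid G]

theorem idm_comp (g : Mor G) (e : g.cod = (idm g.cod).dom) : comp (idm g.cod) g e = g := by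
  obtain ⟨x, y, g⟩ := g
  have key : g ≫ eqToHom rfl ≫ 𝟙 y = g := by simp
  exact congrArg (fun k => (⟨x, y, k⟩ : Mor G)) key

theorem comp_idm (g : Mor G) (e : (idm g.dom).cod = g.dom) : comp g (idm g.dom) e = g := by
  obtain ⟨x, y, g⟩ := g
  have key : 𝟙 x ≫ eqToHom rfl ≫ g = g := by simp
  exact congrArg (fun k => (⟨x, y, k⟩ : Mor G)) key

theorem idm_comp_idm {x y : G} (e : y = x) : comp (idm x) (idm y) e = idm y := by
  subst e
  exact idm_comp (idm y) rfl

/-- In a totally disconnected groupoid with abelian endomorphism groups, inversion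
preserves composition. -/
theorem exists_inv_comp (htd : ∀ f : Mor G, f.dom = f.cod)
    (hab : ∀ (x : G) (a b : x ⟶ x), a ≫ b = b ≫ a) (g h : Mor G) (e : h.cod = g.dom) :
    ∃ e' : h.inv.cod = g.inv.dom, (comp g h e).inv = comp g.inv h.inv e' := by
  have hg := htd g
  have hh := htd h
  obtain ⟨x, y, g⟩ := g
  obtain ⟨z, w, h⟩ := h
  simp only [dom, cod] at hg hh e
  subst hg hh e
  refine ⟨rfl, ?_⟩
  have key : Groupoid.inv (h ≫ eqToHom rfl ≫ g) =
      Groupoid.inv h ≫ eqToHom rfl ≫ Groupoid.inv g := by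
    simp [hab z (CategoryTheory.inv h)]
  exact congrArg (fun k => (⟨z, z, k⟩ : Mor G)) key

end Mor

/-- Membership in the comultiplication relation of a groupoid. -/
theorem mem_comultiplication_iff {G : Type*} [Groupoid G] (f g h : Mor G) :
    (f, (g, h)) ∈ {p : Mor G × (Mor G × Mor G) |
      ∃ (g h : Mor G) (e : Mor.cod h = Mor.dom g), p = (Mor.comp g h e, (g, h))} ↔
      ∃ e : h.cod = g.dom, f = Mor.comp g h e := by
  constructor
  · rintro ⟨g', h', e, hp⟩
    simp only [Prod.mk.injEq] at hp
    obtain ⟨rfl, rfl, rfl⟩ := hp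
    exact ⟨e, rfl⟩
  · rintro ⟨e, rfl⟩
    exact ⟨g, h, e, rfl⟩

/-- If `G` is a totally disconnected groupoid with abelian endomorphism groups,
then the relation `Δ = {(f, (g,h)) : g ∘ h is defined and g ∘ h = f}` is a
broadcasting relation on `G` (commutative dagger Frobenius structures are
broadcastable via their comultiplication). -/
theorem comultiplication_broadcasts {G : Type*} [Groupoid G]
    (htd : ∀ f : Mor G, f.dom = f.cod)
    (hab : ∀ (x : G) (a b : x ⟶ x), a ≫ b = b ≫ a) :
    IsBroadcasting {p : Mor G × (Mor G × Mor G) |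
      ∃ (g h : Mor G) (e : Mor.cod h = Mor.dom g),
        p = (Mor.comp g h e, (g, h))} := by
  simp only [IsBroadcasting, mem_comultiplication_iff]
  refine ⟨fun f g h => ⟨?_, ?_⟩, ?_, fun f g => ⟨?_, ?_⟩, fun f g => ⟨?_, ?_⟩⟩
  · rintro ⟨e, rfl⟩
    exact Mor.exists_inv_comp htd hab g h e
  · rintro ⟨e, hf⟩
    have key := Mor.exists_inv_comp htd hab g.inv h.inv e
    rw [← hf] at key
    simpa only [Mor.inv_inv] using key
  · rintro f g h ⟨e, rfl⟩
    have hgh : h.dom = g.dom := (htd h).trans e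
    exact ⟨hgh, (Mor.idm_comp_idm hgh).symm⟩
  · rintro ⟨e, rfl⟩
    exact Mor.idm_comp g e
  · rintro rfl
    exact ⟨rfl, (Mor.idm_comp f rfl).symm⟩
  · rintro ⟨e, rfl⟩
    exact Mor.comp_idm g e
  · rintro rfl
    exact ⟨rfl, (Mor.comp_idm f rfl).symm⟩
end

section
/- Let G be a group with unit e, regarded as a one-object groupoid. Then the relation B = {(f, (e, f)) : f ∈ G} ∪ {(f, (f, e)) : f ∈ G} ⊆ G × (G × G) is a broadcasting relation on G. In particular, if G is nonabelian (there exist g, h ∈ G with g·h ≠ h·g), then G is a broadcastable object of CP*[Rel] whose multiplication is noncommutative; hence in CP*[Rel] broadcastability does not imply commutativity (no broadcasting is strictly stronger than noncommutativity). -/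
open CategoryTheory

/-- An element of a group `G`, as a bundled morphism of the one-object groupoid
`SingleObj G`. -/
def grpMor (G : Type*) [Group G] (f : G) : Mor (SingleObj G) :=
  ⟨SingleObj.star G, SingleObj.star G, f⟩

theorem exists_eq_grpMor {G : Type*} [Group G] (m : Mor (SingleObj G)) :
    ∃ f : G, m = grpMor G f :=
  ⟨m.2.2, rfl⟩

theorem grpMor_injective (G : Type*) [Group G] : Function.Injective (grpMor G) := by
  intro a b h
  exact eq_of_heq (Sigma.mk.inj (eq_of_heq (Sigma.mk.inj h).2)).2

theorem grpMor_inv {G : Type*} [Group G] (f : G) : (grpMor G f).inv = grpMor G f⁻¹ := rfl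

theorem idm_eq_grpMor_one {G : Type*} [Group G] (x : SingleObj G) :
    Mor.idm x = grpMor G 1 := rfl

/-- Membership in the relation `{(f, (e, f))} ∪ {(f, (f, e))}` on a group. -/
theorem exists_grpMor_triple_iff {G : Type*} [Group G] (f g h : G) :
    (∃ k : G, (grpMor G f, (grpMor G g, grpMor G h)) =
          (grpMor G k, (grpMor G 1, grpMor G k)) ∨
        (grpMor G f, (grpMor G g, grpMor G h)) =
          (grpMor G k, (grpMor G k, grpMor G 1))) ↔
      (g = 1 ∧ h = f) ∨ (g = f ∧ h = 1) := by
  simp only [Prod.mk.injEq, (grpMor_injective G).eq_iff]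
  grind

theorem isBroadcasting_group (G : Type*) [Group G] :
    IsBroadcasting {p : Mor (SingleObj G) × (Mor (SingleObj G) × Mor (SingleObj G)) |
      ∃ f : G, p = (grpMor G f, (grpMor G 1, grpMor G f)) ∨
               p = (grpMor G f, (grpMor G f, grpMor G 1))} := by
  refine ⟨fun f g h => ?_, fun f g h _ => ?_, fun f g => ?_, fun f g => ?_⟩
  · obtain ⟨f, rfl⟩ := exists_eq_grpMor f
    obtain ⟨g, rfl⟩ := exists_eq_grpMor g
    obtain ⟨h, rfl⟩ := exists_eq_grpMor h
    simp only [grpMor_inv, Set.mem_ofPred_eq, exists_grpMor_triple_iff, inv_eq_one, inv_inj]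
  · exact ⟨1, Or.inl rfl⟩
  all_goals
    obtain ⟨f, rfl⟩ := exists_eq_grpMor f
    obtain ⟨g, rfl⟩ := exists_eq_grpMor g
    simp only [idm_eq_grpMor_one, Set.mem_ofPred_eq, exists_grpMor_triple_iff,
      (grpMor_injective G).eq_iff]
    grind

/-- For a group `G` (a one-object groupoid), the relation
`B = {(f,(e,f)) : f ∈ G} ∪ {(f,(f,e)) : f ∈ G}` is a broadcasting relation;
moreover, if `G` is nonabelian, then `G` is a broadcastable object of `CP*[Rel]`
whose multiplication is noncommutative — so in `CP*[Rel]` broadcastability does not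
imply commutativity. -/
theorem group_broadcastable (G : Type*) [Group G] :
    IsBroadcasting {p : Mor (SingleObj G) × (Mor (SingleObj G) × Mor (SingleObj G)) |
      ∃ f : G, p = (grpMor G f, (grpMor G 1, grpMor G f)) ∨
               p = (grpMor G f, (grpMor G f, grpMor G 1))} ∧
    ((∃ g h : G, g * h ≠ h * g) →
      ∃ B : Set (Mor (SingleObj G) × (Mor (SingleObj G) × Mor (SingleObj G))),
        IsBroadcasting B ∧
        ¬ ∀ (x : SingleObj G) (a b : x ⟶ x), a ≫ b = b ≫ a) := by
  refine ⟨isBroadcasting_group G, ?_⟩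
  rintro ⟨g, h, hgh⟩
  exact ⟨_, isBroadcasting_group G, fun hcomm => hgh (hcomm (SingleObj.star G) h g)⟩
end
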